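/- arXiv:1205.0495 — 4 statements merged into one kernel-verified Lean document; each statement's English description precedes it below -/
import Mathlib

section
/- Let G be an infinite group with a finite generating set S, and let p be a positive natural number. Then every 0-chain on G with coefficients in ℤ/pℤ is a boundary: for every function c : G → ZMod p there exists a function ψ : G × S → ZMod p (interpreted as a 1-chain assigning to each oriented Cayley-graph edge (x, x·s) the coefficient ψ(x, s)) such that for every v ∈ G, c v = (∑_{s ∈ S} ψ(v·s⁻¹, s)) − (∑_{s ∈ S} ψ(v, s)). In other words, the 0-dimensional coarse locally finite homology HX₀(G, ℤ/pℤ) vanishes. -/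
open Filter Topology in
/-- A closed additive subgroup of `X → A` containing all differences `a δ_x - a δ_y` is everything,
when `X` is infinite and `A` is discrete. -/
theorem AddSubgroup.eq_top_of_isClosed_of_single_sub_single_mem {X A : Type*} [Infinite X]
    [DecidableEq X] [AddCommGroup A] [TopologicalSpace A] [DiscreteTopology A]
    (H : AddSubgroup (X → A)) (hH : IsClosed (H : Set (X → A)))
    (hsub : ∀ (x y : X) (a : A), Pi.single x a - Pi.single y a ∈ H) : H = ⊤ := by
  have hsingle (x : X) (a : A) : Pi.single x a ∈ H := by
    have hlim : Tendsto (fun y : X ↦ (Pi.single x a - Pi.single y a : X → A)) cofinite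
        (𝓝 (Pi.single x a)) := by
      refine tendsto_pi_nhds.2 fun v ↦ tendsto_const_nhds.congr' ?_
      filter_upwards [(Set.finite_singleton v).compl_mem_cofinite] with y hy
      have hvy : v ≠ y := fun h ↦ hy h.symm
      simp [Pi.single_eq_of_ne hvy]
    exact hH.mem_of_tendsto hlim (Eventually.of_forall fun y ↦ hsub x y a)
  refine (AddSubgroup.eq_top_iff' H).2 fun c ↦ ?_
  have hlim : HasSum (fun x ↦ (Pi.single x (c x) : X → A)) c := by
    refine Pi.hasSum.2 fun v ↦ ?_
    simpa using hasSum_single (f := fun x ↦ (Pi.single x (c x) : X → A) v) v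
      fun x hx ↦ Pi.single_eq_of_ne hx.symm _
  exact hH.mem_of_tendsto hlim
    (Eventually.of_forall fun F ↦ H.sum_mem fun x _ ↦ hsingle x (c x))

/-- The boundary map from 1-chains on the Cayley graph of `(G, S)` to 0-chains on `G`. -/
def cayleyBoundary {G : Type*} [Group G] (S : Finset G) (A : Type*) [AddCommGroup A] :
    (G × S → A) →+ (G → A) where
  toFun ψ v := (∑ s : S, ψ (v * (s : G)⁻¹, s)) - ∑ s : S, ψ (v, s)
  map_zero' := by ext; simp
  map_add' ψ φ := by
    ext v
    simp only [Pi.add_apply, Finset.sum_add_distrib]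
    abel

theorem cayleyBoundary_apply {G : Type*} [Group G] (S : Finset G) {A : Type*} [AddCommGroup A]
    (ψ : G × S → A) (v : G) :
    cayleyBoundary S A ψ v = (∑ s : S, ψ (v * (s : G)⁻¹, s)) - ∑ s : S, ψ (v, s) :=
  rfl

theorem cayleyBoundary_single {G : Type*} [Group G] [DecidableEq G] (S : Finset G) {A : Type*}
    [AddCommGroup A] (x : G) (s : S) (a : A) :
    cayleyBoundary S A (Pi.single (x, s) a) = Pi.single (x * s) a - Pi.single x a := by
  ext v
  rw [cayleyBoundary_apply, Pi.sub_apply]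
  congr 1
  · rw [Finset.sum_eq_single s (fun t _ ht ↦ by simp [ht]) (by simp)]
    simp [Pi.single_apply, mul_inv_eq_iff_eq_mul]
  · rw [Finset.sum_eq_single s (fun t _ ht ↦ by simp [ht]) (by simp)]
    simp [Pi.single_apply]

/-- When `S` generates `G`, the difference of any two point masses is a boundary. -/
theorem single_sub_single_mem_range_cayleyBoundary {G : Type*} [Group G] [DecidableEq G]
    {S : Finset G} (hS : Subgroup.closure (S : Set G) = ⊤) {A : Type*} [AddCommGroup A]
    (x y : G) (a : A) :
    (Pi.single x a - Pi.single y a : G → A) ∈ (cayleyBoundary S A).range := by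
  have key (g : G) (hg : g ∈ Subgroup.closure (S : Set G)) :
      ∀ x, (Pi.single (x * g) a - Pi.single x a : G → A) ∈ (cayleyBoundary S A).range := by
    induction hg using Subgroup.closure_induction with
    | mem s hs => exact fun x ↦ ⟨_, cayleyBoundary_single S x ⟨s, hs⟩ a⟩
    | one => simp [zero_mem]
    | mul g h _ _ hg hh =>
      intro x
      simpa [mul_assoc] using add_mem (hh (x * g)) (hg x)
    | inv g _ hg =>
      intro x
      simpa using neg_mem (hg (x * g⁻¹))
  simpa using key (y⁻¹ * x) (hS ▸ Subgroup.mem_top _) y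

theorem continuous_cayleyBoundary {G : Type*} [Group G] (S : Finset G) (A : Type*)
    [AddCommGroup A] [TopologicalSpace A] [IsTopologicalAddGroup A] :
    Continuous (cayleyBoundary S A) := by
  refine continuous_pi fun v ↦ ?_
  simp only [cayleyBoundary_apply]
  fun_prop

theorem cayleyBoundary_surjective {G : Type*} [Group G] [Infinite G] {S : Finset G}
    (hS : Subgroup.closure (S : Set G) = ⊤) (A : Type*) [AddCommGroup A] [Finite A] :
    Function.Surjective (cayleyBoundary S A) := by
  classical
  let : TopologicalSpace A := ⊥
  have : DiscreteTopology A := ⟨rfl⟩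
  refine AddMonoidHom.range_eq_top.1 <|
    AddSubgroup.eq_top_of_isClosed_of_single_sub_single_mem _ ?_
      (single_sub_single_mem_range_cayleyBoundary hS)
  rw [AddMonoidHom.coe_range]
  exact (isCompact_range (continuous_cayleyBoundary S A)).isClosed

/-- For an infinite finitely generated group `G` (generated by a
finite set `S`) and `p > 0`, every 0-chain with coefficients in `ZMod p` is the
boundary of a 1-chain supported on the Cayley graph edges, i.e.
`HX₀(G, ℤ/pℤ) = 0`. -/
theorem coarse_homology_degree_zero_vanishes
    (G : Type*) [Group G] [Infinite G] (S : Finset G)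
    (hS : Subgroup.closure (S : Set G) = ⊤) (p : ℕ) (hp : 0 < p)
    (c : G → ZMod p) :
    ∃ ψ : G × S → ZMod p, ∀ v : G,
      c v = (∑ s : S, ψ (v * (s : G)⁻¹, s)) - ∑ s : S, ψ (v, s) := by
  have : NeZero p := ⟨hp.ne'⟩
  obtain ⟨ψ, hψ⟩ := cayleyBoundary_surjective hS (ZMod p) c
  exact ⟨ψ, fun v ↦ by rw [← hψ, cayleyBoundary_apply]⟩
end

section
/- Let V be an infinite type, and let Γ be a connected, locally finite simple graph on V. Then for every positive natural number p, every 0-chain on V with coefficients in ℤ/pℤ is the boundary of a 1-chain supported on edges of Γ: for every c : V → ZMod p there exists an antisymmetric function ψ : V × V → ZMod p with ψ(x, y) = 0 whenever x and y are not adjacent in Γ, such that for every v ∈ V, c v = ∑_{w ∈ neighbors of v} ψ(w, v). -/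
namespace SimpleGraph

variable {V A : Type*} [AddCommGroup A] (Γ : SimpleGraph V)

/-- The `A`-valued 1-chains on `V × V` supported on the edges of a graph. -/
def edgeChains (A : Type*) [AddCommGroup A] : AddSubgroup (V × V → A) where
  carrier := {ψ | (∀ x y, ψ (x, y) = -ψ (y, x)) ∧ ∀ x y, ¬ Γ.Adj x y → ψ (x, y) = 0}
  zero_mem' := by simp
  add_mem' := by
    rintro ψ φ ⟨h₁, h₂⟩ ⟨h₃, h₄⟩
    refine ⟨fun x y ↦ ?_, fun x y h ↦ by simp [h₂ x y h, h₄ x y h]⟩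
    rw [Pi.add_apply, Pi.add_apply, h₁ x y, h₃ x y, neg_add]
  neg_mem' := by
    rintro ψ ⟨h₁, h₂⟩
    refine ⟨fun x y ↦ ?_, fun x y h ↦ by simp [h₂ x y h]⟩
    rw [Pi.neg_apply, Pi.neg_apply, h₁ x y]

variable [∀ v, Fintype (Γ.neighborSet v)]

/-- The boundary operator from functions on ordered pairs to 0-chains. -/
def chainBoundary (A : Type*) [AddCommGroup A] : (V × V → A) →+ (V → A) where
  toFun ψ v := ∑ w ∈ Γ.neighborFinset v, ψ (w, v)
  map_zero' := by ext; simp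
  map_add' ψ φ := by ext; simp [Finset.sum_add_distrib]

/-- The 0-chains that bound a 1-chain supported on the edges. -/
def boundaries (A : Type*) [AddCommGroup A] : AddSubgroup (V → A) :=
  (Γ.edgeChains A).map (Γ.chainBoundary A)

variable {Γ}

lemma Adj.single_sub_single_mem_boundaries [DecidableEq V] {x y : V} (h : Γ.Adj x y) (a : A) :
    (Pi.single x a - Pi.single y a : V → A) ∈ Γ.boundaries A := by
  refine ⟨Pi.single (y, x) a - Pi.single (x, y) a, ⟨fun u v ↦ ?_, fun u v huv ↦ ?_⟩, ?_⟩
  · simp only [Pi.sub_apply, Pi.single_apply, Prod.mk.injEq, neg_sub, and_comm]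
  · have h₁ : (u, v) ≠ (y, x) := by rintro ⟨⟩; exact huv h.symm
    have h₂ : (u, v) ≠ (x, y) := by rintro ⟨⟩; exact huv h
    simp [h₁, h₂]
  · have key {x y : V} (h : Γ.Adj x y) :
        Γ.chainBoundary A (Pi.single (y, x) a) = Pi.single x a := by
      ext v
      rcases eq_or_ne v x with rfl | hv
      · simp [chainBoundary, Pi.single_apply, h]
      · simp [chainBoundary, hv]
    rw [map_sub, key h, key h.symm]

lemma Reachable.single_sub_single_mem_boundaries [DecidableEq V] {x y : V}
    (h : Γ.Reachable x y) (a : A) :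
    (Pi.single x a - Pi.single y a : V → A) ∈ Γ.boundaries A := by
  obtain ⟨p⟩ := h
  induction p with
  | nil => simp [zero_mem]
  | cons h _ ih => simpa using add_mem (h.single_sub_single_mem_boundaries a) ih

/-- In an infinite connected graph every 0-chain agrees with a boundary on any finite set. -/
lemma Connected.exists_mem_boundaries_eqOn [Infinite V] (hΓ : Γ.Connected) (c : V → A)
    (S : Finset V) : ∃ b ∈ Γ.boundaries A, Set.EqOn b c S := by
  classical
  obtain ⟨w, hw⟩ := Infinite.exists_notMem_finset S
  refine ⟨∑ v ∈ S, (Pi.single v (c v) - Pi.single w (c v)), sum_mem fun v _ ↦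
    (hΓ v w).single_sub_single_mem_boundaries (c v), fun u hu ↦ ?_⟩
  have huw : u ≠ w := by rintro rfl; exact hw hu
  have hu' : u ∈ S := hu
  simp [Finset.sum_apply, Pi.single_apply, huw, hu']

/-- In an infinite connected locally finite graph, every 0-chain with coefficients in a finite
group is a boundary. -/
theorem Connected.boundaries_eq_top [Infinite V] [Finite A] (hΓ : Γ.Connected) :
    Γ.boundaries A = ⊤ := by
  refine (AddSubgroup.eq_top_iff' _).2 fun c ↦ ?_
  let : TopologicalSpace A := ⊥
  have : DiscreteTopology A := ⟨rfl⟩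
  have hclosed : IsClosed (Γ.edgeChains A : Set (V × V → A)) := by
    have h : (Γ.edgeChains A : Set (V × V → A)) =
        (⋂ x, ⋂ y, {ψ | ψ (x, y) = -ψ (y, x)}) ∩
          ⋂ x, ⋂ y, ⋂ _ : ¬ Γ.Adj x y, {ψ | ψ (x, y) = 0} := by
      ext ψ
      simp [edgeChains]
    rw [h]
    exact (isClosed_iInter fun x ↦ isClosed_iInter fun y ↦
        isClosed_eq (by fun_prop) (by fun_prop)).inter <|
      isClosed_iInter fun x ↦ isClosed_iInter fun y ↦ isClosed_iInter fun _ ↦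
        isClosed_eq (by fun_prop) (by fun_prop)
  obtain ⟨ψ, hψ, hψc⟩ := hclosed.isCompact.inter_iInter_nonempty
    (fun v ↦ {ψ | Γ.chainBoundary A ψ v = c v})
    (fun v ↦ isClosed_eq (continuous_finsetSum _ fun w _ ↦ continuous_apply (w, v))
      continuous_const)
    (fun S ↦ by
      obtain ⟨_, ⟨ψ, hψ, rfl⟩, h⟩ := hΓ.exists_mem_boundaries_eqOn c S
      exact ⟨ψ, hψ, Set.mem_iInter₂.2 fun v hv ↦ h hv⟩)
  exact ⟨ψ, hψ, funext fun v ↦ Set.mem_iInter.1 hψc v⟩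

end SimpleGraph

/-- On a connected, locally finite simple graph with infinitely
many vertices, every 0-chain with coefficients in `ZMod p` (`p > 0`) is the
boundary of a 1-chain supported on the edges of the graph. -/
theorem zero_chain_is_boundary_of_connected_locallyFinite_infinite_graph
    (V : Type*) [Infinite V] (Γ : SimpleGraph V) (hΓ : Γ.Connected)
    [hlf : ∀ v : V, Fintype (Γ.neighborSet v)]
    (p : ℕ) (hp : 0 < p) (c : V → ZMod p) :
    ∃ ψ : V × V → ZMod p,
      (∀ x y : V, ψ (x, y) = -ψ (y, x)) ∧
      (∀ x y : V, ¬ Γ.Adj x y → ψ (x, y) = 0) ∧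
      (∀ v : V, c v = ∑ w ∈ Γ.neighborFinset v, ψ (w, v)) := by
  have : NeZero p := ⟨hp.ne'⟩
  obtain ⟨ψ, ⟨hanti, hsupp⟩, hψ⟩ : c ∈ Γ.boundaries (ZMod p) :=
    hΓ.boundaries_eq_top (A := ZMod p) ▸ AddSubgroup.mem_top c
  exact ⟨ψ, hanti, hsupp, fun v ↦ (congrFun hψ v).symm⟩
end

section
/- Let G be a group with a finite generating set S, let p be a positive natural number, and let H be a subgroup of G of finite index. Suppose ψ : G × S → ZMod p is invariant under left translation by H, i.e., ψ(h·x, s) = ψ(x, s) for all h ∈ H, x ∈ G, s ∈ S, and suppose that for every v ∈ G, (∑_{s ∈ S} ψ(v·s⁻¹, s)) − (∑_{s ∈ S} ψ(v, s)) = 1. Then the index [G : H] is congruent to 0 modulo p, i.e., (H.index : ZMod p) = 0. -/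
/-- If a 1-chain `ψ` on the Cayley graph of `(G, S)` with
coefficients in `ZMod p` is invariant under left translation by a finite index
subgroup `H` and its boundary is the fundamental class, then
`[G : H] ≡ 0 (mod p)`. -/
theorem index_zero_mod_p_of_periodic_bounding_chain
    (G : Type*) [Group G] (S : Finset G)
    (hS : Subgroup.closure (S : Set G) = ⊤) (p : ℕ) (hp : 0 < p)
    (H : Subgroup G) (hH : H.index ≠ 0)
    (ψ : G × S → ZMod p)
    (hinv : ∀ h ∈ H, ∀ x : G, ∀ s : S, ψ (h * x, s) = ψ (x, s))
    (hbd : ∀ v : G,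
      (∑ s : S, ψ (v * (s : G)⁻¹, s)) - ∑ s : S, ψ (v, s) = 1) :
    (H.index : ZMod p) = 0 := by
  have : H.FiniteIndex := ⟨hH⟩
  have : Fintype (G ⧸ H) := Fintype.ofFinite _
  -- Inversion turns left `H`-invariance into a function on left cosets.
  let f : S → G ⧸ H → ZMod p := fun s => Quotient.lift (fun x : G => ψ (x⁻¹, s)) (by
    intro a b hab
    have hmem : a⁻¹ * b ∈ H := QuotientGroup.leftRel_apply.mp hab
    have h := hinv _ hmem b⁻¹ s
    simpa using h)
  have hf (q : G ⧸ H) : (∑ s : S, f s ((s : G) • q)) - ∑ s : S, f s q = 1 := by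
    induction q using QuotientGroup.induction_on with
    | H x =>
      have h := hbd x⁻¹
      simp only [← mul_inv_rev] at h
      exact h
  have hperm (s : S) : ∑ q : G ⧸ H, f s ((s : G) • q) = ∑ q : G ⧸ H, f s q :=
    Equiv.sum_comp (MulAction.toPerm (s : G)) (f s)
  calc (H.index : ZMod p) = ∑ _q : G ⧸ H, (1 : ZMod p) := by
        simp [Subgroup.index_eq_card, Nat.card_eq_fintype_card]
    _ = ∑ q : G ⧸ H, ((∑ s : S, f s ((s : G) • q)) - ∑ s : S, f s q) := by
        simp only [hf]
    _ = 0 := by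
        rw [Finset.sum_sub_distrib, Finset.sum_comm, Finset.sum_congr rfl fun s _ => hperm s,
          Finset.sum_comm, sub_self]
end

section
/- Let G be an infinite group with a finite generating set S, and let p be a positive natural number such that for every finite-index subgroup H of G, p does not divide the index [G : H]. Then no nontrivially periodic bounding chain for the fundamental class exists: for every finite-index subgroup H of G and every ψ : G × S → ZMod p satisfying ψ(h·x, s) = ψ(x, s) for all h ∈ H, x ∈ G, s ∈ S, it is not the case that for every v ∈ G, (∑_{s ∈ S} ψ(v·s⁻¹, s)) − (∑_{s ∈ S} ψ(v, s)) = 1. -/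
/-- If `G` is an infinite group generated by a finite set `S` and
`p > 0` does not divide the index of any finite index subgroup of `G`, then no
`H`-periodic 1-chain (for `H` of finite index) bounds the fundamental class. -/
theorem no_periodic_bounding_chain
    (G : Type*) [Group G] [Infinite G] (S : Finset G)
    (hS : Subgroup.closure (S : Set G) = ⊤) (p : ℕ) (hp : 0 < p)
    (hdvd : ∀ H : Subgroup G, H.index ≠ 0 → ¬ p ∣ H.index) :
    ∀ H : Subgroup G, H.index ≠ 0 →
      ∀ ψ : G × S → ZMod p,
        (∀ h ∈ H, ∀ x : G, ∀ s : S, ψ (h * x, s) = ψ (x, s)) →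
        ¬ (∀ v : G,
            (∑ s : S, ψ (v * (s : G)⁻¹, s)) - ∑ s : S, ψ (v, s) = 1) := by
  intro H hH ψ hψ hbound
  refine hdvd H hH ((ZMod.natCast_eq_zero_iff _ _).mp ?_)
  have : H.FiniteIndex := ⟨hH⟩
  let _ : Fintype (G ⧸ H) := H.fintypeQuotientOfFiniteIndex
  -- Inversion turns the `H`-orbits into left cosets, and right translation into the action of `G`.
  let f (s : S) : G ⧸ H → ZMod p := fun q ↦ Quotient.liftOn' q (fun x ↦ ψ (x⁻¹, s)) (by
    intro a b hab
    have h := hψ _ (QuotientGroup.leftRel_apply.mp hab) b⁻¹ s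
    simpa [mul_assoc] using h)
  have hf (q : G ⧸ H) : (∑ s : S, f s ((s : G) • q)) - ∑ s : S, f s q = 1 := by
    induction q using QuotientGroup.induction_on with
    | H x =>
      have hs (s : S) : f s ((s : G) • (x : G ⧸ H)) = ψ (x⁻¹ * (s : G)⁻¹, s) := by
        rw [← mul_inv_rev]
        rfl
      simp_rw [hs]
      exact hbound x⁻¹
  calc (H.index : ZMod p) = ∑ _q : G ⧸ H, (1 : ZMod p) := by
        simp [Subgroup.index, Nat.card_eq_fintype_card]
    _ = ∑ q : G ⧸ H, ((∑ s : S, f s ((s : G) • q)) - ∑ s : S, f s q) := by simp_rw [hf]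
    _ = 0 := by
        rw [Finset.sum_sub_distrib, sub_eq_zero, Finset.sum_comm, Finset.sum_comm (γ := G ⧸ H)]
        exact Finset.sum_congr rfl fun s _ ↦ Equiv.sum_comp (MulAction.toPerm (s : G)) (f s)
end
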